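/- arXiv:1206.2083 — 4 statements merged into one kernel-verified Lean document; each statement's English description precedes it below -/
import Mathlib

section
/- Variational formulation of the Funk metric: let Ω be a bounded open convex subset of Euclidean space ℝ^d, let x and y be distinct points of Ω, and let b be the point where the ray from x through y meets the frontier of Ω, i.e. b ∈ frontier Ω and b = x + T • (y − x) for some real T > 1. Then the number log(dist(x,b)/dist(y,b)) is the greatest element (IsGreatest) of the set of all numbers log(Metric.infDist x π / Metric.infDist y π), where π ranges over boundary hyperplanes of closed half-spaces containing Ω, i.e. π = {z : f z = c} for a nonzero continuous linear functional f : ℝ^d → ℝ and a real number c with f z ≤ c for all z ∈ Ω. In particular F(x,y) := log(dist(x,b)/dist(y,b)) equals the supremum of log(infDist x π / infDist y π) over all such hyperplanes, and the supremum is attained at a supporting hyperplane of Ω at b. -/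
/-- The distance from a point to an affine hyperplane of a Hilbert space. -/
theorem Metric.infDist_hyperplane {E : Type*} [NormedAddCommGroup E] [InnerProductSpace ℝ E]
    [CompleteSpace E] {f : E →L[ℝ] ℝ} (hf : f ≠ 0) (c : ℝ) (x : E) :
    Metric.infDist x {z | f z = c} = |f x - c| / ‖f‖ := by
  have hn : 0 < ‖f‖ := norm_pos_iff.mpr hf
  obtain ⟨v, hv⟩ := (InnerProductSpace.toDual ℝ E).surjective f
  have hnv : ‖v‖ = ‖f‖ := by rw [← hv, LinearIsometryEquiv.norm_map]
  have hfv : f v = ‖f‖ ^ 2 := by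
    rw [← hnv, ← hv, InnerProductSpace.toDual_apply_apply, real_inner_self_eq_norm_sq]
  have hz : x - ((f x - c) / ‖f‖ ^ 2) • v ∈ {z | f z = c} := by
    simp only [Set.mem_ofPred_eq, map_sub, map_smul, hfv, smul_eq_mul]
    field_simp
    ring
  apply le_antisymm
  · refine (Metric.infDist_le_dist_of_mem hz).trans_eq ?_
    rw [dist_eq_norm, sub_sub_cancel, norm_smul, hnv, Real.norm_eq_abs, abs_div,
      abs_of_pos (pow_pos hn 2)]
    field_simp
  · refine (Metric.le_infDist ⟨_, hz⟩).mpr fun z hz => ?_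
    rw [div_le_iff₀ hn, ← show f z = c from hz, ← map_sub, dist_eq_norm, mul_comm]
    exact f.le_opNorm (x - z)

/-- A nonzero continuous linear functional does not attain its supremum on an open set. -/
theorem IsOpen.lt_of_forall_le_of_ne_zero {E : Type*} [NormedAddCommGroup E] [NormedSpace ℝ E]
    {s : Set E} (hs : IsOpen s) {f : E →L[ℝ] ℝ} (hf : f ≠ 0) {c : ℝ} (h : ∀ z ∈ s, f z ≤ c)
    {x : E} (hx : x ∈ s) : f x < c := by
  refine (h x hx).lt_of_ne fun hc => hf ?_
  have hmax : IsLocalMax f x := by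
    filter_upwards [hs.mem_nhds hx] with z hz
    exact (h z hz).trans_eq hc.symm
  exact hmax.hasFDerivAt_eq_zero f.hasFDerivAt


/-- Variational formulation of the Funk metric: for a bounded open convex set Ω ⊆ ℝ^d,
distinct points x, y ∈ Ω, and b the point where the ray from x through y meets the
frontier of Ω, the number log(dist(x,b)/dist(y,b)) is the greatest element of the set
of numbers log(infDist x π / infDist y π) as π ranges over boundary hyperplanes of
closed half-spaces containing Ω. -/
theorem funk_metric_variational (d : ℕ) (Ω : Set (EuclideanSpace ℝ (Fin d)))
    (hconv : Convex ℝ Ω) (hopen : IsOpen Ω) (hbdd : Bornology.IsBounded Ω)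
    (x y b : EuclideanSpace ℝ (Fin d)) (hx : x ∈ Ω) (hy : y ∈ Ω) (hxy : x ≠ y)
    (T : ℝ) (hT : 1 < T) (hbray : b = x + T • (y - x)) (hbfr : b ∈ frontier Ω) :
    IsGreatest
      {r : ℝ | ∃ (f : EuclideanSpace ℝ (Fin d) →L[ℝ] ℝ) (c : ℝ),
        f ≠ 0 ∧ (∀ z ∈ Ω, f z ≤ c) ∧
        r = Real.log (Metric.infDist x {z | f z = c} / Metric.infDist y {z | f z = c})}
      (Real.log (dist x b / dist y b)) := by
  have hT0 : 0 < T - 1 := sub_pos.mpr hT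
  have hdist : dist x b / dist y b = T / (T - 1) := by
    have hn : ‖y - x‖ ≠ 0 := norm_ne_zero_iff.mpr (sub_ne_zero.mpr hxy.symm)
    have h1 : dist x b = T * ‖y - x‖ := by
      rw [dist_comm, dist_eq_norm, hbray, add_sub_cancel_left, norm_smul, Real.norm_eq_abs,
        abs_of_pos (by linarith)]
    have h2 : dist y b = (T - 1) * ‖y - x‖ := by
      rw [dist_comm, dist_eq_norm, hbray,
        show x + T • (y - x) - y = (T - 1) • (y - x) by module, norm_smul, Real.norm_eq_abs,
        abs_of_pos hT0]
    rw [h1, h2, mul_div_mul_right _ _ hn]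
  have hratio : ∀ (f : EuclideanSpace ℝ (Fin d) →L[ℝ] ℝ) (c : ℝ), f ≠ 0 → f x < c → f y < c →
      Metric.infDist x {z | f z = c} / Metric.infDist y {z | f z = c} =
        (c - f x) / (c - f y) := by
    intro f c hf hfx hfy
    rw [Metric.infDist_hyperplane hf, Metric.infDist_hyperplane hf,
      div_div_div_cancel_right₀ (norm_ne_zero_iff.mpr hf), abs_of_neg (sub_neg.mpr hfx),
      abs_of_neg (sub_neg.mpr hfy), neg_sub, neg_sub]
  have hfb : ∀ f : EuclideanSpace ℝ (Fin d) →L[ℝ] ℝ, f b = f x + T * (f y - f x) := by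
    intro f
    rw [hbray, map_add, map_smul, map_sub, smul_eq_mul]
  rw [hdist]
  constructor
  · have hb : b ∉ Ω := by
      rw [hopen.frontier_eq] at hbfr
      exact hbfr.2
    obtain ⟨f, hf⟩ := geometric_hahn_banach_open_point hconv hopen hb
    have hf0 : f ≠ 0 := by
      rintro rfl
      simpa using hf x hx
    refine ⟨f, f b, hf0, fun z hz => (hf z hz).le, ?_⟩
    rw [hratio f _ hf0 (hf x hx) (hf y hy)]
    congr 1
    rw [div_eq_div_iff hT0.ne' (sub_pos.mpr (hf y hy)).ne', hfb]
    ring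
  · rintro r ⟨f, c, hf0, hf, rfl⟩
    have hfx := hopen.lt_of_forall_le_of_ne_zero hf0 hf hx
    have hfy := hopen.lt_of_forall_le_of_ne_zero hf0 hf hy
    have hbc : f b ≤ c :=
      closure_minimal hf (isClosed_le f.continuous continuous_const) (frontier_subset_closure hbfr)
    rw [hratio f c hf0 hfx hfy]
    apply Real.log_le_log (div_pos (sub_pos.mpr hfx) (sub_pos.mpr hfy))
    rw [div_le_div_iff₀ (sub_pos.mpr hfy) hT0]
    rw [hfb] at hbc
    linarith
end

section
/- Supporting half-space distance-ratio inequality: let E be a real normed vector space, f : E → ℝ a nonzero continuous linear functional, and c ∈ ℝ. Let x, b ∈ E satisfy f x ≤ c and f b ≤ c, and let y = x + t • (b − x) for some t ∈ [0,1]. Then, with π = {z : f z = c}, one has Metric.infDist x π · dist(y, b) ≤ Metric.infDist y π · dist(x, b). (In other words, among all half-spaces {f ≤ c} containing both x and b, the distance ratio infDist(x,π)/infDist(y,π) is maximized by hyperplanes passing through b, where it equals dist(x,b)/dist(y,b).) -/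
/-- If the gap `c - f y` is at least `s` times the gap `c - f x`, then the distances to the
hyperplane `{z | f z = c}` compare in the same way. -/
theorem mul_infDist_level_le {E : Type*} [NormedAddCommGroup E] [NormedSpace ℝ E]
    {f : E →L[ℝ] ℝ} (hf : f ≠ 0) {c s : ℝ} {x y : E} (hx : f x ≤ c) (hs : 0 ≤ s)
    (h : s * (c - f x) ≤ c - f y) :
    s * Metric.infDist x {z | f z = c} ≤ Metric.infDist y {z | f z = c} := by
  rcases hs.eq_or_lt with rfl | hs
  · simpa using Metric.infDist_nonneg
  rcases hx.eq_or_lt with hx | hx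
  · rw [Metric.infDist_zero_of_mem (show x ∈ {z | f z = c} from hx), mul_zero]
    exact Metric.infDist_nonneg
  have hgap : 0 < c - f x := sub_pos.2 hx
  have hy : 0 < c - f y := (mul_pos hs hgap).trans_le h
  have hne : {z | f z = c}.Nonempty :=
    f.toLinearMap.surjective (by exact_mod_cast hf) c
  refine (Metric.le_infDist hne).2 fun z (hz : f z = c) => ?_
  have hmem : x + ((c - f x) / (c - f y)) • (z - y) ∈ {z | f z = c} := by
    simp only [Set.mem_ofPred_eq, map_add, map_smul, map_sub, hz, smul_eq_mul]
    rw [div_mul_cancel₀ _ hy.ne']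
    ring
  calc s * Metric.infDist x {z | f z = c}
      ≤ s * ((c - f x) / (c - f y) * dist y z) := by
        gcongr
        refine (Metric.infDist_le_dist_of_mem hmem).trans_eq ?_
        rw [dist_self_add_right, norm_smul, Real.norm_of_nonneg (div_pos hgap hy).le,
          dist_comm, dist_eq_norm]
    _ = s * (c - f x) / (c - f y) * dist y z := by ring
    _ ≤ dist y z := mul_le_of_le_one_left dist_nonneg ((div_le_one hy).2 h)

/-- Supporting half-space distance-ratio inequality: if the closed half-space {f ≤ c}
contains both x and b, and y lies on the segment from x to b, then with π = {z : f z = c}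
one has infDist(x,π)·dist(y,b) ≤ infDist(y,π)·dist(x,b). -/
theorem infDist_ratio_le_of_halfspace (E : Type*) [NormedAddCommGroup E]
    [NormedSpace ℝ E] (f : E →L[ℝ] ℝ) (hf : f ≠ 0) (c : ℝ) (x b : E)
    (hx : f x ≤ c) (hb : f b ≤ c) (y : E) (t : ℝ) (ht0 : 0 ≤ t) (ht1 : t ≤ 1)
    (hy : y = x + t • (b - x)) :
    Metric.infDist x {z | f z = c} * dist y b
      ≤ Metric.infDist y {z | f z = c} * dist x b := by
  have hdist : dist y b = (1 - t) * dist x b := by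
    have : y - b = (1 - t) • (x - b) := by rw [hy]; module
    rw [dist_eq_norm, this, norm_smul, Real.norm_of_nonneg (sub_nonneg.2 ht1), dist_eq_norm]
  have hgap : (1 - t) * (c - f x) ≤ c - f y := by
    have : f y = f x + t * (f b - f x) := by simp [hy]
    nlinarith [mul_nonneg ht0 (sub_nonneg.2 hb)]
  calc Metric.infDist x {z | f z = c} * dist y b
      = (1 - t) * Metric.infDist x {z | f z = c} * dist x b := by rw [hdist]; ring
    _ ≤ Metric.infDist y {z | f z = c} * dist x b := by
        gcongr
        exact mul_infDist_level_le hf hx (sub_nonneg.2 ht1) hgap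
end

section
/- An infinite-dimensional Hilbert space is not an FR space: let H be a real inner product space admitting an orthonormal sequence e : ℕ → H. Then for every ε₀ with 0 < ε₀ < 1 and every D₀ > 0, there exists a bounded subset S ⊆ H whose metric diameter D = Metric.diam S satisfies D > D₀, such that S is not contained in any closed ball of radius (1 − ε₀) · D / √2. (One may take S = {r • e i : i ∈ ℕ} for suitable r > 0: its diameter is r√2 while every closed ball containing S has radius at least r.) -/
open Filter Topology in
theorem Orthonormal.tendsto_inner_zero {H : Type*} [NormedAddCommGroup H]
    [InnerProductSpace ℝ H] {e : ℕ → H} (he : Orthonormal ℝ e) (c : H) :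
    Tendsto (fun i => inner ℝ (e i) c) atTop (𝓝 0) := by
  have h := (he.inner_products_summable c).tendsto_atTop_zero
  rw [tendsto_zero_iff_norm_tendsto_zero]
  simpa [Real.sqrt_sq_eq_abs] using h.sqrt

theorem Orthonormal.dist_smul_smul {H ι : Type*} [NormedAddCommGroup H]
    [InnerProductSpace ℝ H] {e : ι → H} (he : Orthonormal ℝ e) {r : ℝ} (hr : 0 ≤ r)
    {i j : ι} (hij : i ≠ j) : dist (r • e i) (r • e j) = r * Real.sqrt 2 := by
  have h : ‖e i - e j‖ ^ 2 = 2 := by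
    rw [norm_sub_sq_real, he.1, he.1, he.2 hij]
    norm_num
  rw [dist_eq_norm, ← smul_sub, norm_smul, Real.norm_of_nonneg hr, ← h,
    Real.sqrt_sq (norm_nonneg _)]

theorem Orthonormal.dist_smul_smul_le {H ι : Type*} [NormedAddCommGroup H]
    [InnerProductSpace ℝ H] {e : ι → H} (he : Orthonormal ℝ e) {r : ℝ} (hr : 0 ≤ r)
    (i j : ι) : dist (r • e i) (r • e j) ≤ r * Real.sqrt 2 := by
  rcases eq_or_ne i j with rfl | hij
  · rw [dist_self]
    positivity
  · exact (he.dist_smul_smul hr hij).le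

theorem Orthonormal.isBounded_range_smul {H ι : Type*} [NormedAddCommGroup H]
    [InnerProductSpace ℝ H] {e : ι → H} (he : Orthonormal ℝ e) {r : ℝ} (hr : 0 ≤ r) :
    Bornology.IsBounded (Set.range fun i => r • e i) :=
  Metric.isBounded_range_iff.2 ⟨_, he.dist_smul_smul_le hr⟩

theorem Orthonormal.diam_range_smul {H ι : Type*} [Nontrivial ι] [NormedAddCommGroup H]
    [InnerProductSpace ℝ H] {e : ι → H} (he : Orthonormal ℝ e) {r : ℝ} (hr : 0 ≤ r) :
    Metric.diam (Set.range fun i => r • e i) = r * Real.sqrt 2 := by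
  obtain ⟨i, j, hij⟩ := exists_pair_ne ι
  apply le_antisymm
  · refine Metric.diam_le_of_forall_dist_le (by positivity) ?_
    rintro _ ⟨i, rfl⟩ _ ⟨j, rfl⟩
    exact he.dist_smul_smul_le hr i j
  · rw [← he.dist_smul_smul hr hij]
    exact Metric.dist_le_diam_of_mem (he.isBounded_range_smul hr) ⟨i, rfl⟩ ⟨j, rfl⟩

theorem Orthonormal.le_of_range_smul_subset_closedBall {H : Type*} [NormedAddCommGroup H]
    [InnerProductSpace ℝ H] {e : ℕ → H} (he : Orthonormal ℝ e) {r ρ : ℝ} {c : H}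
    (h : (Set.range fun i => r • e i) ⊆ Metric.closedBall c ρ) : r ≤ ρ := by
  have hle : ∀ i, r ^ 2 - 2 * r * inner ℝ (e i) c ≤ ρ ^ 2 := fun i => by
    have hi : ‖r • e i - c‖ ≤ ρ := mem_closedBall_iff_norm.1 (h ⟨i, rfl⟩)
    have hsq := pow_le_pow_left₀ (norm_nonneg _) hi 2
    rw [norm_sub_sq_real, norm_smul, he.1, real_inner_smul_left, mul_one, Real.norm_eq_abs,
      sq_abs] at hsq
    nlinarith [sq_nonneg ‖c‖]
  have hlim := ((he.tendsto_inner_zero c).const_mul (2 * r)).const_sub (r ^ 2)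
  rw [mul_zero, sub_zero] at hlim
  have hρ : 0 ≤ ρ := dist_nonneg.trans (Metric.mem_closedBall.1 (h ⟨0, rfl⟩))
  exact le_of_abs_le (abs_le_of_sq_le_sq (le_of_tendsto' hlim hle) hρ)

/-- An infinite-dimensional Hilbert space is not an FR space: given an orthonormal
sequence, for every 0 < ε₀ < 1 and D₀ > 0 there is a bounded subset S of diameter
D > D₀ not contained in any closed ball of radius (1 − ε₀)·D/√2. -/
theorem not_FR_of_orthonormal_sequence (H : Type*) [NormedAddCommGroup H]
    [InnerProductSpace ℝ H] (e : ℕ → H) (he : Orthonormal ℝ e)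
    (ε₀ D₀ : ℝ) (hε₀ : 0 < ε₀) (hε₁ : ε₀ < 1) (hD₀ : 0 < D₀) :
    ∃ S : Set H, Bornology.IsBounded S ∧ D₀ < Metric.diam S ∧
      ∀ c : H, ¬ S ⊆ Metric.closedBall c ((1 - ε₀) * Metric.diam S / Real.sqrt 2) := by
  have h2 : 1 < Real.sqrt 2 := Real.one_lt_sqrt_two
  have hdiam := he.diam_range_smul hD₀.le
  refine ⟨Set.range fun i => D₀ • e i, he.isBounded_range_smul hD₀.le, ?_, fun c hc => ?_⟩
  · rw [hdiam]
    exact lt_mul_of_one_lt_right hD₀ h2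
  · have hle := he.le_of_range_smul_subset_closedBall hc
    rw [hdiam, ← mul_assoc, mul_div_cancel_right₀ _ (by positivity)] at hle
    nlinarith [mul_pos hε₀ hD₀]
end

section
/- The standard simplex realizes the optimal FR constant of ℝ^k: fix k ≥ 1 and r > 0, and in EuclideanSpace ℝ (Fin (k+1)) consider the k+1 points x i = r • (standard basis vector e_i), i ∈ Fin (k+1). Then: (a) the metric diameter of the set {x i} equals r·√2; (b) the number r·√(k/(k+1)) is the least element of the set {ρ : ∃ c, ∀ i, dist c (x i) ≤ ρ}, the least radius being attained at the centroid c = (r/(k+1)) • (e_0 + ⋯ + e_k). Consequently the diameter-to-circumradius ratio of this configuration equals √2·√((k+1)/k), i.e. the circumradius equals D·√(k/(2(k+1))) where D is the diameter. -/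
lemma dist_sq_smul_single {ι : Type*} [Fintype ι] [DecidableEq ι]
    (c : EuclideanSpace ℝ ι) (r : ℝ) (i : ι) :
    dist c (r • EuclideanSpace.single i (1 : ℝ)) ^ 2 = ∑ j, c j ^ 2 - 2 * r * c i + r ^ 2 := by
  rw [dist_eq_norm, norm_sub_sq_real, EuclideanSpace.real_norm_sq_eq, norm_smul, mul_pow,
    inner_smul_right, EuclideanSpace.inner_single_right]
  simp
  ring

lemma dist_smul_single_of_ne {ι : Type*} [Fintype ι] [DecidableEq ι]
    {r : ℝ} (hr : 0 ≤ r) {i j : ι} (hij : i ≠ j) :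
    dist (r • EuclideanSpace.single i (1 : ℝ)) (r • EuclideanSpace.single j (1 : ℝ)) =
      r * √2 := by
  rw [← sq_eq_sq₀ dist_nonneg (by positivity), dist_sq_smul_single, mul_pow,
    Real.sq_sqrt (by norm_num)]
  simp [hij.symm]
  ring

lemma card_sub_one_mul_sq_le_sum_dist_sq {ι : Type*} [Fintype ι] [DecidableEq ι]
    (c : EuclideanSpace ℝ ι) (r : ℝ) :
    ((Fintype.card ι : ℝ) - 1) * r ^ 2 ≤
      ∑ i, dist c (r • EuclideanSpace.single i (1 : ℝ)) ^ 2 := by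
  have hcs : (∑ i, c i) ^ 2 ≤ (Fintype.card ι : ℝ) * ∑ i, c i ^ 2 := by
    simpa using sq_sum_le_card_mul_sum_sq (s := Finset.univ) (f := fun i => c i)
  simp_rw [dist_sq_smul_single]
  rw [Finset.sum_add_distrib, Finset.sum_sub_distrib, ← Finset.mul_sum]
  simp only [Finset.sum_const, Finset.card_univ, nsmul_eq_mul]
  nlinarith [sq_nonneg (∑ i, c i - r)]

lemma dist_centroid_smul_single (k : ℕ) {r : ℝ} (hr : 0 ≤ r) (i : Fin (k + 1)) :
    dist ((r / ((k : ℝ) + 1)) • ∑ j, EuclideanSpace.single j (1 : ℝ))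
      (r • EuclideanSpace.single i (1 : ℝ)) = r * √((k : ℝ) / ((k : ℝ) + 1)) := by
  rw [← sq_eq_sq₀ dist_nonneg (by positivity), dist_sq_smul_single, mul_pow,
    Real.sq_sqrt (by positivity)]
  have hc (j : Fin (k + 1)) :
      ((r / ((k : ℝ) + 1)) • ∑ j, EuclideanSpace.single j (1 : ℝ) :
        EuclideanSpace ℝ (Fin (k + 1))) j = r / ((k : ℝ) + 1) := by
    simp [Finset.sum_apply, Pi.single_apply]
  simp only [hc, Finset.sum_const, Finset.card_univ, Fintype.card_fin, nsmul_eq_mul]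
  push_cast
  field_simp
  ring

/-- The standard simplex realizes the optimal FR constant of ℝ^k: for the points
x i = r • e_i in ℝ^(k+1), (a) the diameter of {x i} is r·√2; (b) r·√(k/(k+1)) is the
least circumradius, attained at the centroid (r/(k+1)) • ∑ e_j; consequently the
circumradius equals D·√(k/(2(k+1))) where D is the diameter. -/
theorem standard_simplex_FR_constant (k : ℕ) (hk : 1 ≤ k) (r : ℝ) (hr : 0 < r) :
    let x : Fin (k + 1) → EuclideanSpace ℝ (Fin (k + 1)) :=
      fun i => r • EuclideanSpace.single i (1 : ℝ)
    Metric.diam (Set.range x) = r * Real.sqrt 2 ∧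
    IsLeast {ρ : ℝ | ∃ c : EuclideanSpace ℝ (Fin (k + 1)), ∀ i, dist c (x i) ≤ ρ}
      (r * Real.sqrt ((k : ℝ) / ((k : ℝ) + 1))) ∧
    (∀ i, dist ((r / ((k : ℝ) + 1)) • ∑ j, EuclideanSpace.single j (1 : ℝ)) (x i)
      ≤ r * Real.sqrt ((k : ℝ) / ((k : ℝ) + 1))) ∧
    r * Real.sqrt ((k : ℝ) / ((k : ℝ) + 1))
      = (r * Real.sqrt 2) * Real.sqrt ((k : ℝ) / (2 * ((k : ℝ) + 1))) := by
  intro x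
  have hcen := dist_centroid_smul_single k hr.le
  refine ⟨le_antisymm ?_ ?_, ⟨⟨_, fun i => (hcen i).le⟩, ?_⟩, fun i => (hcen i).le, ?_⟩
  · refine Metric.diam_le_of_forall_dist_le (by positivity) ?_
    rintro _ ⟨i, rfl⟩ _ ⟨j, rfl⟩
    by_cases hij : i = j
    · rw [hij, dist_self]
      positivity
    · exact (dist_smul_single_of_ne hr.le hij).le
  · have h01 : (0 : Fin (k + 1)) ≠ Fin.last k := by
      rw [Ne, Fin.ext_iff, Fin.val_zero, Fin.val_last]
      lia
    rw [← dist_smul_single_of_ne hr.le h01]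
    exact Metric.dist_le_diam_of_mem (Set.finite_range x).isBounded ⟨_, rfl⟩ ⟨_, rfl⟩
  · rintro ρ ⟨c, hc⟩
    have hρ : 0 ≤ ρ := dist_nonneg.trans (hc 0)
    have hsum : ∑ i, dist c (x i) ^ 2 ≤ ((k : ℝ) + 1) * ρ ^ 2 := by
      have := Finset.sum_le_sum fun i (_ : i ∈ Finset.univ) =>
        pow_le_pow_left₀ dist_nonneg (hc i) 2
      simpa using this
    have hlow := (card_sub_one_mul_sq_le_sum_dist_sq c r).trans hsum
    simp only [Fintype.card_fin, Nat.cast_add, Nat.cast_one, add_sub_cancel_right] at hlow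
    rw [← sq_le_sq₀ (by positivity) hρ, mul_pow, Real.sq_sqrt (by positivity), mul_div_assoc',
      div_le_iff₀ (by positivity)]
    linarith
  · rw [mul_assoc, ← Real.sqrt_mul (by norm_num)]
    congr 2
    field_simp
end
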